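/- arXiv:1907.00605 — 7 statements merged into one kernel-verified Lean document; each statement's English description precedes it below -/
import Mathlib

section
/- Consider a d-dimensional generalized assignment instance with bins j ∈ [m] of capacities b_j ∈ ℝ_{>0}^d, and items i with weight vectors w_{i,j} ∈ ℝ_{≥0}^d and profits p_{i,j} ≥ 0, in which every packing option is heavy (for every i, j there exists t ∈ [d] with w_{i,j}^t > b_j^t/2). Then for every feasible packing P there exists a feasible packing P' ⊆ P in which every bin receives at most one item and whose total profit ∑_{(i,j)∈P'} p_{i,j} is at least (1/d) · ∑_{(i,j)∈P} p_{i,j}. In particular, the maximum weight of a matching of items to bins along feasible packing options is at least (1/d) times the optimal profit of the heavy instance. -/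
/-- A packing `P` of items into bins is feasible if every item is packed at most
once and no bin's capacity is exceeded in any dimension. -/
def VGAP.Feasible {n m d : ℕ} (w : Fin n → Fin m → Fin d → ℝ)
    (b : Fin m → Fin d → ℝ) (P : Finset (Fin n × Fin m)) : Prop :=
  (∀ i : Fin n, (P.filter fun q => q.1 = i).card ≤ 1) ∧
  (∀ j : Fin m, ∀ t : Fin d, ∑ q ∈ P.filter (fun q => q.2 = j), w q.1 q.2 t ≤ b j t)

/-- In a VGAP instance in which every packing option is heavy, every feasible
packing `P` contains a feasible sub-packing `P'` assigning at most one item per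
bin (i.e. a matching of items to bins) with at least a `1/d` fraction of the
profit of `P`. -/
theorem heavy_packing_exists_matching {n m d : ℕ} (hd : 1 ≤ d)
    (b : Fin m → Fin d → ℝ) (hb : ∀ j t, 0 < b j t)
    (w : Fin n → Fin m → Fin d → ℝ) (hw : ∀ i j t, 0 ≤ w i j t)
    (p : Fin n → Fin m → ℝ) (hp : ∀ i j, 0 ≤ p i j)
    (hheavy : ∀ i j, ∃ t, w i j t > b j t / 2)
    (P : Finset (Fin n × Fin m)) (hP : VGAP.Feasible w b P) :
    ∃ P' ⊆ P, VGAP.Feasible w b P' ∧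
      (∀ j : Fin m, (P'.filter fun q => q.2 = j).card ≤ 1) ∧
      (1 / (d : ℝ)) * ∑ q ∈ P, p q.1 q.2 ≤ ∑ q ∈ P', p q.1 q.2 := by
  classical
  choose τ hτ using hheavy
  have hmono : ∀ Q ⊆ P, VGAP.Feasible w b Q := by
    intro Q hQ
    refine ⟨fun i => ?_, fun j t => ?_⟩
    · exact (Finset.card_le_card (Finset.filter_subset_filter _ hQ)).trans (hP.1 i)
    · refine (Finset.sum_le_sum_of_subset_of_nonneg
        (Finset.filter_subset_filter _ hQ) ?_).trans (hP.2 j t)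
      intro q _ _
      exact hw _ _ _
  have hsum : ∑ t : Fin d, ∑ q ∈ P with τ q.1 q.2 = t, p q.1 q.2 = ∑ q ∈ P, p q.1 q.2 :=
    Finset.sum_fiberwise P (fun q => τ q.1 q.2) (fun q => p q.1 q.2)
  have hd0 : (0 : ℝ) < d := by exact_mod_cast hd
  obtain ⟨t, -, ht⟩ : ∃ t ∈ (Finset.univ : Finset (Fin d)),
      (1 / (d : ℝ)) * ∑ q ∈ P, p q.1 q.2 ≤ ∑ q ∈ P with τ q.1 q.2 = t, p q.1 q.2 := by
    apply Finset.exists_le_of_sum_le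
    · exact ⟨⟨0, hd⟩, Finset.mem_univ _⟩
    · rw [hsum, Finset.sum_const, Finset.card_univ, Fintype.card_fin, nsmul_eq_mul]
      apply le_of_eq
      field_simp
  refine ⟨P.filter (fun q => τ q.1 q.2 = t), Finset.filter_subset _ _,
    hmono _ (Finset.filter_subset _ _), fun j => ?_, ht⟩
  rw [Finset.card_le_one]
  intro x hx y hy
  by_contra hne
  simp only [Finset.mem_filter] at hx hy
  obtain ⟨⟨hxP, hxt⟩, hxj⟩ := hx
  obtain ⟨⟨hyP, hyt⟩, hyj⟩ := hy
  have hsub : ({x, y} : Finset (Fin n × Fin m)) ⊆ P.filter (fun q => q.2 = j) := by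
    intro z hz
    simp only [Finset.mem_insert, Finset.mem_singleton] at hz
    rcases hz with rfl | rfl <;> simp [*]
  have h1 := (Finset.sum_le_sum_of_subset_of_nonneg (f := fun q => w q.1 q.2 t) hsub
    (fun q _ _ => hw _ _ _)).trans (hP.2 j t)
  rw [Finset.sum_pair hne] at h1
  have hx2 := hτ x.1 x.2
  have hy2 := hτ y.1 y.2
  rw [hxt, hxj] at hx2
  rw [hyt, hyj] at hy2
  rw [hxj, hyj] at h1
  linarith
end

section
/- Consider a {0,1}-VGAP instance with m bins, each of capacity 1 in every one of the d dimensions, items i with weight vectors w_{i,j} ∈ {0,1}^d and profits p_{i,j} ≥ 0, in which every packing option is dense (every w_{i,j} has at least √d nonzero entries). Then for every feasible packing P there exists a feasible packing P' ⊆ P in which every bin receives at most one item and whose total profit is at least (1/√d) · ∑_{(i,j)∈P} p_{i,j}. In particular, the maximum weight of a matching of items to bins is at least (1/√d) times the optimal profit of the dense instance. -/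
/-- A packing `P` of items into bins of a `{0,1}`-VGAP instance (all bins have
capacity `1` in every dimension) is feasible if every item is packed at most
once and no bin's capacity is exceeded in any dimension. -/
def ZeroOneVGAP.Feasible {n m d : ℕ} (w : Fin n → Fin m → Fin d → ℝ)
    (P : Finset (Fin n × Fin m)) : Prop :=
  (∀ i : Fin n, (P.filter fun q => q.1 = i).card ≤ 1) ∧
  (∀ j : Fin m, ∀ t : Fin d, ∑ q ∈ P.filter (fun q => q.2 = j), w q.1 q.2 t ≤ 1)

/-- In a `{0,1}`-VGAP instance in which every packing option is dense, every
feasible packing `P` contains a feasible sub-packing `P'` assigning at most one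
item per bin (i.e. a matching of items to bins) with at least a `1/√d` fraction
of the profit of `P`. -/
theorem dense_packing_exists_matching {n m d : ℕ} (hd : 1 ≤ d)
    (w : Fin n → Fin m → Fin d → ℝ) (hw01 : ∀ i j t, w i j t = 0 ∨ w i j t = 1)
    (p : Fin n → Fin m → ℝ) (hp : ∀ i j, 0 ≤ p i j)
    (hdense : ∀ i j,
      Real.sqrt d ≤ ((Finset.univ.filter fun t => w i j t ≠ 0).card : ℝ))
    (P : Finset (Fin n × Fin m)) (hP : ZeroOneVGAP.Feasible w P) :
    ∃ P' ⊆ P, ZeroOneVGAP.Feasible w P' ∧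
      (∀ j : Fin m, (P'.filter fun q => q.2 = j).card ≤ 1) ∧
      (1 / Real.sqrt d) * ∑ q ∈ P, p q.1 q.2 ≤ ∑ q ∈ P', p q.1 q.2 := by
  classical
  have hdpos : (0 : ℝ) < d := by exact_mod_cast hd
  have hs : 0 < Real.sqrt d := Real.sqrt_pos.mpr hdpos
  have hw0 : ∀ i j t, 0 ≤ w i j t := by
    intro i j t
    rcases hw01 i j t with h | h <;> rw [h] <;> norm_num
  have hsum : ∀ i j, Real.sqrt d ≤ ∑ t, w i j t := by
    intro i j
    refine (hdense i j).trans (le_of_eq ?_)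
    rw [Finset.card_filter]
    push_cast
    refine Finset.sum_congr rfl fun t _ => ?_
    rcases hw01 i j t with h | h <;> simp [h]
  have hcard : ∀ j, ((P.filter fun q => q.2 = j).card : ℝ) ≤ Real.sqrt d := by
    intro j
    have h1 : ((P.filter fun q => q.2 = j).card : ℝ) * Real.sqrt d ≤ d := by
      calc ((P.filter fun q => q.2 = j).card : ℝ) * Real.sqrt d
          = ∑ q ∈ P.filter (fun q => q.2 = j), Real.sqrt d := by simp
        _ ≤ ∑ q ∈ P.filter (fun q => q.2 = j), ∑ t, w q.1 q.2 t :=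
            Finset.sum_le_sum fun q _ => hsum q.1 q.2
        _ = ∑ t, ∑ q ∈ P.filter (fun q => q.2 = j), w q.1 q.2 t := Finset.sum_comm
        _ ≤ ∑ t : Fin d, (1 : ℝ) := Finset.sum_le_sum fun t _ => hP.2 j t
        _ = d := by simp
    have h2 : Real.sqrt d * Real.sqrt d = d := Real.mul_self_sqrt hdpos.le
    exact le_of_mul_le_mul_right (h1.trans h2.ge) hs
  have hex : ∀ j, ∃ S ⊆ P.filter (fun q => q.2 = j), S.card ≤ 1 ∧
      (1 / Real.sqrt d) * ∑ q ∈ P.filter (fun q => q.2 = j), p q.1 q.2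
        ≤ ∑ q ∈ S, p q.1 q.2 := by
    intro j
    rcases (P.filter fun q => q.2 = j).eq_empty_or_nonempty with h | h
    · exact ⟨∅, by simp, by simp, by simp [h]⟩
    · obtain ⟨a, ha, hmax⟩ := Finset.exists_max_image _ (fun q : Fin n × Fin m => p q.1 q.2) h
      refine ⟨{a}, by simpa using ha, by simp, ?_⟩
      have h3 := Finset.sum_le_card_nsmul _ (fun q : Fin n × Fin m => p q.1 q.2) _ hmax
      rw [nsmul_eq_mul] at h3
      have h4 := mul_le_mul_of_nonneg_right (hcard j) (hp a.1 a.2)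
      rw [Finset.sum_singleton, one_div, inv_mul_le_iff₀ hs]
      exact h3.trans h4
  choose S hSsub hScard hSsum using hex
  have hfil : ∀ j, (P.filter fun q => q ∈ S q.2).filter (fun q => q.2 = j) = S j := by
    intro j
    ext q
    simp only [Finset.mem_filter]
    constructor
    · rintro ⟨⟨_, h⟩, rfl⟩
      exact h
    · intro h
      have h' := Finset.mem_filter.mp (hSsub j h)
      exact ⟨⟨h'.1, by rw [h'.2]; exact h⟩, h'.2⟩
  refine ⟨P.filter fun q => q ∈ S q.2, Finset.filter_subset _ _, ⟨?_, ?_⟩, ?_, ?_⟩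
  · intro i
    exact (Finset.card_le_card
      (Finset.filter_subset_filter _ (Finset.filter_subset _ _))).trans (hP.1 i)
  · intro j t
    exact (Finset.sum_le_sum_of_subset_of_nonneg
      (Finset.filter_subset_filter _ (Finset.filter_subset _ _))
      fun q _ _ => hw0 _ _ _).trans (hP.2 j t)
  · intro j
    rw [hfil]
    exact hScard j
  · rw [← Finset.sum_fiberwise P (fun q => q.2),
      ← Finset.sum_fiberwise (P.filter fun q => q ∈ S q.2) (fun q => q.2), Finset.mul_sum]
    refine Finset.sum_le_sum fun j _ => ?_
    rw [hfil]
    exact hSsum j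
end

section
/- Let m ≥ 2 and d ≥ 1 be integers and let u : [m] × [d] → ℝ_{≥0} be an array of bin loads such that for every pair of bins j < j' there exists a dimension t ∈ [d] with u(j,t) + u(j',t) > 1. Then ∑_{j∈[m]} ∑_{t∈[d]} u(j,t) ≥ m/2. -/
/-- First Fit lemma: if the loads `u` of `m ≥ 2` bins in `d` dimensions are
nonnegative and every pair of distinct bins is jointly overloaded past
capacity `1` in some dimension, then the total load is at least `m/2`. -/
theorem firstFit_total_load (m d : ℕ) (hm : 2 ≤ m) (hd : 1 ≤ d)
    (u : Fin m → Fin d → ℝ) (hu : ∀ j t, 0 ≤ u j t)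
    (hpair : ∀ j j' : Fin m, j < j' → ∃ t, u j t + u j' t > 1) :
    (m : ℝ) / 2 ≤ ∑ j : Fin m, ∑ t : Fin d, u j t := by
  obtain ⟨n, rfl⟩ : ∃ n, m = n + 2 := ⟨m - 2, by omega⟩
  have key : ∀ j j' : Fin (n + 2), j < j' → 1 ≤ (∑ t, u j t) + ∑ t, u j' t := by
    intro j j' h
    obtain ⟨t, ht⟩ := hpair j j' h
    have h1 := Finset.single_le_sum (f := u j) (fun i _ => hu j i) (Finset.mem_univ t)
    have h2 := Finset.single_le_sum (f := u j') (fun i _ => hu j' i) (Finset.mem_univ t)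
    linarith
  have key2 : ∀ j : Fin (n + 2), 1 ≤ (∑ t, u j t) + ∑ t, u (j + 1) t := by
    intro j
    have hne : j ≠ j + 1 := by simp
    rcases lt_or_gt_of_ne hne with h | h
    · exact key _ _ h
    · have := key _ _ h
      linarith
  have hsum := Finset.sum_le_sum (s := Finset.univ) (fun j _ => key2 j)
  rw [Finset.sum_add_distrib] at hsum
  have hrot : ∑ j : Fin (n + 2), ∑ t, u (j + 1) t = ∑ j : Fin (n + 2), ∑ t, u j t :=
    Equiv.sum_comp (Equiv.addRight (1 : Fin (n + 2))) (fun j => ∑ t, u j t)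
  rw [hrot] at hsum
  simp only [Finset.sum_const, Finset.card_univ, Fintype.card_fin, nsmul_eq_mul, mul_one] at hsum
  linarith
end

section
/- Let d ≥ 1 be an integer, let 1 ≤ j < i be integers, and let ε > 0 satisfy ε·j·d^j < 1/2 and ε·i·d^i < 1/2. Then for every pair of column indices k, ℓ ∈ [d] there exists a dimension t ∈ [d] such that (A_j)_{t,k} + (A_i)_{t,ℓ} > 1; that is, no column of A_j can be packed in the unit bin together with any column of A_i. -/
/-- The matrix `A_j = (1 − εjd^j)·I + εjd^{j−1}·(𝟙𝟙ᵀ − I)`: diagonal entries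
`1 − εjd^j` and off-diagonal entries `εjd^{j−1}`. -/
noncomputable def lowerBoundMatrix (ε : ℝ) (d j : ℕ) : Matrix (Fin d) (Fin d) ℝ :=
  fun t k => if t = k then 1 - ε * j * (d : ℝ) ^ j else ε * j * (d : ℝ) ^ (j - 1)

/-- No column of `A_j` can be packed in the unit bin together with any column
of `A_i` when `j < i`: for every pair of columns there is a dimension in which
their entries sum to more than `1`. -/
theorem lowerBoundMatrix_columns_conflict (d i j : ℕ) (hd : 1 ≤ d)
    (hj : 1 ≤ j) (hji : j < i) (ε : ℝ) (hε : 0 < ε)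
    (hεj : ε * j * (d : ℝ) ^ j < 1 / 2) (hεi : ε * i * (d : ℝ) ^ i < 1 / 2) :
    ∀ k ℓ : Fin d, ∃ t : Fin d,
      lowerBoundMatrix ε d j t k + lowerBoundMatrix ε d i t ℓ > 1 := by
  intro k ℓ
  refine ⟨k, ?_⟩
  by_cases h : k = ℓ
  · simp only [lowerBoundMatrix, h, if_true]
    linarith
  · simp only [lowerBoundMatrix, h, if_true, if_false]
    have hd' : (1 : ℝ) ≤ d := by exact_mod_cast hd
    have hp : (d : ℝ) ^ j ≤ (d : ℝ) ^ (i - 1) := pow_le_pow_right₀ hd' (by omega)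
    have hpos : (0 : ℝ) < (d : ℝ) ^ j := by positivity
    have hij : (j : ℝ) < i := by exact_mod_cast hji
    have h1 : ε * j * (d : ℝ) ^ j < ε * i * (d : ℝ) ^ j := by gcongr
    have h2 : ε * i * (d : ℝ) ^ j ≤ ε * i * (d : ℝ) ^ (i - 1) := by gcongr
    linarith
end

section
/- Let d ≥ 1 and N ≥ 1 be integers and let ε > 0 satisfy ε·N·d^N < 1/2. Consider the items indexed by pairs (j,k) ∈ [N]×[d], where item (j,k) has weight vector equal to the k-th column of A_j. If S ⊆ [N]×[d] is a feasible set, i.e., ∑_{(j,k)∈S} (A_j)_{·,k} ≤ 𝟙 coordinatewise, then all items of S come from the same matrix: any two pairs (j,k), (j',k') ∈ S satisfy j = j'. -/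
theorem lbm_bound (d N : ℕ) (hd : 1 ≤ d) (ε : ℝ) (hε : 0 < ε)
    (hεN : ε * N * (d : ℝ) ^ N < 1 / 2) (j : ℕ) (hj : j ≤ N) :
    ε * j * (d : ℝ) ^ j < 1 / 2 := by
  have hd' : (1 : ℝ) ≤ d := by exact_mod_cast hd
  have hj' : (j : ℝ) ≤ N := by exact_mod_cast hj
  refine lt_of_le_of_lt ?_ hεN
  gcongr

theorem feasible_aux (d N : ℕ) (hd : 1 ≤ d)
    (ε : ℝ) (hε : 0 < ε) (hεN : ε * N * (d : ℝ) ^ N < 1 / 2)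
    (S : Finset (Fin N × Fin d))
    (hS : ∀ t : Fin d, ∑ q ∈ S, lowerBoundMatrix ε d (q.1.1 + 1) t q.2 ≤ 1)
    (q : Fin N × Fin d) (hq : q ∈ S) (q' : Fin N × Fin d) (hq' : q' ∈ S)
    (hlt : q.1.1 < q'.1.1) : False := by
  have hd' : (1 : ℝ) ≤ d := by exact_mod_cast hd
  have hne : q ≠ q' := by
    rintro rfl
    exact lt_irrefl _ hlt
  have hnn : ∀ r ∈ S, 0 ≤ lowerBoundMatrix ε d (r.1.1 + 1) q.2 r.2 := by
    intro r _
    have hb := lbm_bound d N hd ε hε hεN (r.1.1 + 1) r.1.2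
    unfold lowerBoundMatrix
    split_ifs
    · linarith
    · positivity
  have h2 : lowerBoundMatrix ε d (q.1.1 + 1) q.2 q.2
      + lowerBoundMatrix ε d (q'.1.1 + 1) q.2 q'.2 ≤ 1 := by
    rw [← Finset.sum_pair (f := fun r : Fin N × Fin d =>
      lowerBoundMatrix ε d (r.1.1 + 1) q.2 r.2) hne]
    refine le_trans (Finset.sum_le_sum_of_subset_of_nonneg ?_ fun r hr _ => hnn r hr) (hS q.2)
    intro r hr
    simp only [Finset.mem_insert, Finset.mem_singleton] at hr
    rcases hr with rfl | rfl <;> assumption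
  have hb := lbm_bound d N hd ε hε hεN (q.1.1 + 1) q.1.2
  have hb' := lbm_bound d N hd ε hε hεN (q'.1.1 + 1) q'.1.2
  unfold lowerBoundMatrix at h2
  rw [if_pos rfl] at h2
  split_ifs at h2 with hk
  · linarith
  · have hc : ((q.1.1 + 1 : ℕ) : ℝ) < ((q'.1.1 + 1 : ℕ) : ℝ) := by exact_mod_cast Nat.succ_lt_succ hlt
    have hp : (d : ℝ) ^ (q.1.1 + 1) ≤ (d : ℝ) ^ (q'.1.1 + 1 - 1) :=
      pow_le_pow_right₀ hd' (by omega)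
    have h0 : (0 : ℝ) < (d : ℝ) ^ (q.1.1 + 1) := by positivity
    have : ε * ((q.1.1 + 1 : ℕ) : ℝ) * (d : ℝ) ^ (q.1.1 + 1)
        < ε * ((q'.1.1 + 1 : ℕ) : ℝ) * (d : ℝ) ^ (q'.1.1 + 1 - 1) :=
      mul_lt_mul (mul_lt_mul_of_pos_left hc hε) hp h0 (by positivity)
    linarith

/-- Consider the items `(j,k) ∈ [N]×[d]`, where item `(j,k)` has weight vector
the `k`-th column of `A_{j+1}` (so the matrix indices range over `1,…,N`).
Any set `S` of items that fits in the unit bin uses columns of one single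
matrix only. -/
theorem feasible_set_single_matrix (d N : ℕ) (hd : 1 ≤ d) (hN : 1 ≤ N)
    (ε : ℝ) (hε : 0 < ε) (hεN : ε * N * (d : ℝ) ^ N < 1 / 2)
    (S : Finset (Fin N × Fin d))
    (hS : ∀ t : Fin d, ∑ q ∈ S, lowerBoundMatrix ε d (q.1.1 + 1) t q.2 ≤ 1) :
    ∀ q ∈ S, ∀ q' ∈ S, q.1 = q'.1 := by
  intro q hq q' hq'
  rcases lt_trichotomy q.1.1 q'.1.1 with h | h | h
  · exact (feasible_aux d N hd ε hε hεN S hS q hq q' hq' h).elim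
  · exact Fin.ext h
  · exact (feasible_aux d N hd ε hε hεN S hS q' hq' q hq h).elim
end

section
/- Let d ≥ 1 and N ≥ 1 be integers, let ε > 0 satisfy ε·N·d^N < 1/2, and let π : [N]×[d] → ℝ_{≥0} assign a profit to each item (j,k), where item (j,k) has weight vector equal to the k-th column of A_j. Then the maximum of ∑_{(j,k)∈S} π(j,k) over all feasible sets S ⊆ [N]×[d] (those with ∑_{(j,k)∈S} (A_j)_{·,k} ≤ 𝟙 coordinatewise) equals max_{j∈[N]} ∑_{k∈[d]} π(j,k). -/
lemma lbm_small (d N j : ℕ) (hd : 1 ≤ d) (ε : ℝ) (hε : 0 < ε)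
    (hεN : ε * N * (d : ℝ) ^ N < 1 / 2) (hj : j ≤ N) : ε * j * (d : ℝ) ^ j < 1 / 2 := by
  refine lt_of_le_of_lt ?_ hεN
  have h1 : (1 : ℝ) ≤ d := by exact_mod_cast hd
  have h2 : (j : ℝ) ≤ N := by exact_mod_cast hj
  have h3 : (d : ℝ) ^ j ≤ (d : ℝ) ^ N := pow_le_pow_right₀ h1 hj
  gcongr

lemma lbm_nonneg (d N j : ℕ) (hd : 1 ≤ d) (ε : ℝ) (hε : 0 < ε)
    (hεN : ε * N * (d : ℝ) ^ N < 1 / 2) (hj : j ≤ N) (t k : Fin d) :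
    0 ≤ lowerBoundMatrix ε d j t k := by
  have := lbm_small d N j hd ε hε hεN hj
  unfold lowerBoundMatrix
  split_ifs
  · linarith
  · positivity

lemma lbm_conflict (d N i j : ℕ) (hd : 1 ≤ d) (ε : ℝ) (hε : 0 < ε)
    (hεN : ε * N * (d : ℝ) ^ N < 1 / 2) (hij : i < j) (hj : j ≤ N) (k l : Fin d) :
    1 < lowerBoundMatrix ε d i k k + lowerBoundMatrix ε d j k l := by
  have h1 := lbm_small d N i hd ε hε hεN (by omega)
  have h2 := lbm_small d N j hd ε hε hεN hj
  unfold lowerBoundMatrix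
  rw [if_pos rfl]
  split_ifs
  · linarith
  · have hd1 : (1 : ℝ) ≤ d := by exact_mod_cast hd
    have h3 : (d : ℝ) ^ i ≤ (d : ℝ) ^ (j - 1) := pow_le_pow_right₀ hd1 (by omega)
    have h4 : (i : ℝ) < j := by exact_mod_cast hij
    have h5 : ε * i * (d : ℝ) ^ i < ε * j * (d : ℝ) ^ i := by gcongr
    have h6 : ε * j * (d : ℝ) ^ i ≤ ε * j * (d : ℝ) ^ (j - 1) := by gcongr
    linarith

lemma lbm_row (d j : ℕ) (ε : ℝ) (hε : 0 < ε) (t : Fin d) :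
    ∑ k : Fin d, lowerBoundMatrix ε d (j + 1) t k ≤ 1 := by
  have hd : 1 ≤ d := by have := t.2; omega
  rw [← Finset.add_sum_erase _ _ (Finset.mem_univ t)]
  have h : ∑ k ∈ Finset.univ.erase t, lowerBoundMatrix ε d (j + 1) t k
      = ∑ k ∈ Finset.univ.erase t, ε * ((j + 1 : ℕ) : ℝ) * (d : ℝ) ^ j := by
    refine Finset.sum_congr rfl fun k hk => ?_
    have : t ≠ k := fun h => (Finset.mem_erase.mp hk).1 h.symm
    simp [lowerBoundMatrix, this]
  rw [h, Finset.sum_const, Finset.card_erase_of_mem (Finset.mem_univ t), Finset.card_univ,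
    Fintype.card_fin, nsmul_eq_mul, Nat.cast_sub hd]
  simp only [lowerBoundMatrix, if_true]
  have : 0 ≤ ε * ((j + 1 : ℕ) : ℝ) * (d : ℝ) ^ j := by positivity
  rw [pow_succ]
  push_cast at *
  nlinarith

lemma lbm_no_lt (d N : ℕ) (hd : 1 ≤ d) (ε : ℝ) (hε : 0 < ε)
    (hεN : ε * N * (d : ℝ) ^ N < 1 / 2) (S : Finset (Fin N × Fin d))
    (hS : ∀ t : Fin d, ∑ q ∈ S, lowerBoundMatrix ε d (q.1.1 + 1) t q.2 ≤ 1)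
    (p q : Fin N × Fin d) (hp : p ∈ S) (hq : q ∈ S) : ¬ p.1 < q.1 := by
  intro hlt
  have hne : p ≠ q := fun h => by rw [h] at hlt; exact lt_irrefl _ hlt
  have h1 := lbm_conflict d N (p.1.1 + 1) (q.1.1 + 1) hd ε hε hεN
    (by have : p.1.1 < q.1.1 := hlt
        omega) q.1.2 p.2 q.2
  have h2 : ∑ r ∈ {p, q}, lowerBoundMatrix ε d (r.1.1 + 1) p.2 r.2
      ≤ ∑ r ∈ S, lowerBoundMatrix ε d (r.1.1 + 1) p.2 r.2 := by
    refine Finset.sum_le_sum_of_subset_of_nonneg ?_ fun r _ _ =>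
      lbm_nonneg d N _ hd ε hε hεN r.1.2 _ _
    intro r hr
    rcases Finset.mem_insert.mp hr with rfl | hr
    · exact hp
    · rw [Finset.mem_singleton.mp hr]; exact hq
  rw [Finset.sum_pair hne] at h2
  have := hS p.2
  linarith

/-- Consider the items `(j,k) ∈ [N]×[d]`, where item `(j,k)` has weight vector
the `k`-th column of `A_{j+1}` (matrix indices ranging over `1,…,N`) and profit
`π (j,k) ≥ 0`.  The maximum total profit of a set of items fitting in the unit
bin is exactly `max_j ∑_k π (j,k)`. -/
theorem optimal_profit_eq_max_matrix (d N : ℕ) (hd : 1 ≤ d) (hN : 1 ≤ N)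
    (ε : ℝ) (hε : 0 < ε) (hεN : ε * N * (d : ℝ) ^ N < 1 / 2)
    (π : Fin N × Fin d → ℝ) (hπ : ∀ q, 0 ≤ π q) :
    IsGreatest
      {x : ℝ | ∃ S : Finset (Fin N × Fin d),
        (∀ t : Fin d, ∑ q ∈ S, lowerBoundMatrix ε d (q.1.1 + 1) t q.2 ≤ 1) ∧
        x = ∑ q ∈ S, π q}
      (Finset.univ.sup' (Finset.univ_nonempty_iff.mpr ⟨⟨0, hN⟩⟩)
        (fun j : Fin N => ∑ k : Fin d, π (j, k))) := by
  have hinj : ∀ j : Fin N, Function.Injective (fun k : Fin d => (j, k)) :=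
    fun j a b h => (Prod.mk.inj h).2
  constructor
  · obtain ⟨j, -, hj⟩ := Finset.exists_mem_eq_sup' (Finset.univ_nonempty_iff.mpr ⟨⟨0, hN⟩⟩)
      (fun j : Fin N => ∑ k : Fin d, π (j, k))
    refine ⟨Finset.univ.map ⟨fun k : Fin d => (j, k), hinj j⟩, fun t => ?_, ?_⟩
    · rw [Finset.sum_map]
      exact lbm_row d j.1 ε hε t
    · rw [hj, Finset.sum_map]
      rfl
  · rintro x ⟨S, hS, rfl⟩
    have key : ∃ j : Fin N, ∀ q ∈ S, q.1 = j := by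
      rcases S.eq_empty_or_nonempty with rfl | ⟨p, hp⟩
      · exact ⟨⟨0, hN⟩, by simp⟩
      · refine ⟨p.1, fun q hq => ?_⟩
        exact le_antisymm (not_lt.mp (lbm_no_lt d N hd ε hε hεN S hS p q hp hq))
          (not_lt.mp (lbm_no_lt d N hd ε hε hεN S hS q p hq hp))
    obtain ⟨j, hj⟩ := key
    refine le_trans ?_ (Finset.le_sup' (fun j : Fin N => ∑ k : Fin d, π (j, k))
      (Finset.mem_univ j))
    have h1 : ∑ q ∈ S, π q ≤ ∑ q ∈ Finset.univ.map ⟨fun k : Fin d => (j, k), hinj j⟩, π q := by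
      refine Finset.sum_le_sum_of_subset_of_nonneg ?_ fun r _ _ => hπ r
      intro q hq
      rw [Finset.mem_map]
      exact ⟨q.2, Finset.mem_univ _, Prod.ext (hj q hq).symm rfl⟩
    rw [Finset.sum_map] at h1
    exact h1
end

section
/- For every real d ≥ 1, 1 − √d·ln(1 + 1/√d) ≥ 1/(2√d + 4). -/
theorem one_sub_sqrt_log_bound (d : ℝ) (hd : 1 ≤ d) :
    1 - Real.sqrt d * Real.log (1 + 1 / Real.sqrt d) ≥
      1 / (2 * Real.sqrt d + 4) := by
  have hs : 0 < Real.sqrt d := Real.sqrt_pos.mpr (by linarith)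
  generalize Real.sqrt d = s at hs
  have hy : 0 < 1 + 1 / s := by positivity
  have h0 : 0 ≤ Real.log (1 + 1 / s) :=
    Real.log_nonneg (by have : 0 < 1 / s := by positivity
                        linarith)
  have h1 := Real.self_le_sinh_iff.mpr h0
  rw [Real.sinh_eq, Real.exp_neg, Real.exp_log hy] at h1
  have h2 := mul_le_mul_of_nonneg_left h1 hs.le
  have h3 : s * (((1 + 1 / s) - (1 + 1 / s)⁻¹) / 2) = 1 - 1 / (2 * s + 2) := by
    have : s + 1 ≠ 0 := by positivity
    have h5 : (1 + 1 / s)⁻¹ = s / (s + 1) := by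
      field_simp
    rw [h5]
    field_simp
    ring
  have h4 : 1 / (2 * s + 4) ≤ 1 / (2 * s + 2) :=
    one_div_le_one_div_of_le (by positivity) (by linarith)
  linarith
end
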